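/- Let T ≥ 2 and β_2, …, β_T ∈ ℝ. The maximum of ∑_{t=2}^T β_t·l_{t−1} over l ∈ U^CLT exists (is attained) and equals L^CLT · max(0, max_{2≤t≤T} β_t). -/

import Mathlib

/-- The CLT uncertainty set: losses `l : {1,…,T} → ℝ` with `l t ≥ 0` and
`|∑_{t=1}^T l t − T·m̄| ≤ γ₂·σ·√T`. -/
def UCLT (T : ℕ) (m σ γ₂ : ℝ) (l : ℕ → ℝ) : Prop :=
  (∀ t ∈ Finset.Icc 1 T, 0 ≤ l t) ∧
    |(∑ t ∈ Finset.Icc 1 T, l t) - (T : ℝ) * m| ≤ γ₂ * σ * Real.sqrt T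

/-- `L^CLT = T·m̄ + γ₂·σ·√T`. -/
noncomputable def LCLT (T : ℕ) (m σ γ₂ : ℝ) : ℝ :=
  (T : ℝ) * m + γ₂ * σ * Real.sqrt T

/-- Concentrating the whole budget `L^CLT` in a single period is feasible. -/
theorem UCLT_single {T j : ℕ} (hj : j ∈ Finset.Icc 1 T) {m σ γ₂ : ℝ}
    (hm : 0 ≤ m) (hσ : 0 ≤ σ) (hγ : 0 ≤ γ₂) :
    UCLT T m σ γ₂ (Pi.single j (LCLT T m σ γ₂)) := by
  have hL : 0 ≤ LCLT T m σ γ₂ := by unfold LCLT; positivity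
  refine ⟨fun t _ => ?_, ?_⟩
  · rw [Pi.single_apply]
    split_ifs
    exacts [hL, le_rfl]
  have hs : 0 ≤ γ₂ * σ * Real.sqrt T := by positivity
  rw [Finset.sum_pi_single', if_pos hj, LCLT, add_sub_cancel_left, abs_of_nonneg hs]

/-- The total loss of a feasible scenario over the first `T - 1` periods is at most `L^CLT`. -/
theorem UCLT.sum_pred_le {T : ℕ} {m σ γ₂ : ℝ} {l : ℕ → ℝ} (hl : UCLT T m σ γ₂ l) :
    ∑ t ∈ Finset.Icc 2 T, l (t - 1) ≤ LCLT T m σ γ₂ := by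
  have hinj : Set.InjOn (fun t : ℕ => t - 1) (Finset.Icc 2 T) := by
    intro a ha b hb hab
    simp only [Finset.coe_Icc, Set.mem_Icc] at ha hb hab
    omega
  calc ∑ t ∈ Finset.Icc 2 T, l (t - 1)
      = ∑ s ∈ (Finset.Icc 2 T).image (fun t => t - 1), l s := (Finset.sum_image hinj).symm
    _ ≤ ∑ s ∈ Finset.Icc 1 T, l s := by
        refine Finset.sum_le_sum_of_subset_of_nonneg ?_ fun t ht _ => hl.1 t ht
        intro s hs
        simp only [Finset.mem_image, Finset.mem_Icc] at hs ⊢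
        omega
    _ ≤ LCLT T m σ γ₂ := by
        unfold LCLT
        linarith [(abs_le.mp hl.2).2]

/-- The maximum of `∑_{t=2}^T β t · l (t−1)` over `l ∈ U^CLT` is attained and equals
`L^CLT · max(0, max_{2≤t≤T} β t)`. -/
theorem clt_affine_max_attained (T : ℕ) (hT2 : 2 ≤ T) (m σ γ₂ : ℝ)
    (hm : 0 ≤ m) (hσ : 0 ≤ σ) (hγ : 0 ≤ γ₂) (β : ℕ → ℝ) :
    ∃ l : ℕ → ℝ, UCLT T m σ γ₂ l ∧
      (∑ t ∈ Finset.Icc 2 T, β t * l (t - 1)) =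
        LCLT T m σ γ₂ * max 0 ((Finset.Icc 2 T).sup' (Finset.nonempty_Icc.mpr hT2) β) ∧
      ∀ l' : ℕ → ℝ, UCLT T m σ γ₂ l' →
        (∑ t ∈ Finset.Icc 2 T, β t * l' (t - 1)) ≤
          LCLT T m σ γ₂ * max 0 ((Finset.Icc 2 T).sup' (Finset.nonempty_Icc.mpr hT2) β) := by
  set M := (Finset.Icc 2 T).sup' (Finset.nonempty_Icc.mpr hT2) β with hM
  have hbound : ∀ l' : ℕ → ℝ, UCLT T m σ γ₂ l' →
      (∑ t ∈ Finset.Icc 2 T, β t * l' (t - 1)) ≤ LCLT T m σ γ₂ * max 0 M := by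
    intro l' hl'
    calc (∑ t ∈ Finset.Icc 2 T, β t * l' (t - 1))
        ≤ ∑ t ∈ Finset.Icc 2 T, max 0 M * l' (t - 1) := by
          refine Finset.sum_le_sum fun t ht => mul_le_mul_of_nonneg_right
            ((Finset.le_sup' β ht).trans (le_max_right _ _)) (hl'.1 _ ?_)
          rw [Finset.mem_Icc] at ht ⊢
          omega
      _ ≤ max 0 M * LCLT T m σ γ₂ := by
          rw [← Finset.mul_sum]
          exact mul_le_mul_of_nonneg_left hl'.sum_pred_le (le_max_left _ _)
      _ = LCLT T m σ γ₂ * max 0 M := mul_comm _ _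
  rcases le_total M 0 with h | h
  · refine ⟨_, UCLT_single (Finset.mem_Icc.mpr ⟨by omega, le_refl T⟩) hm hσ hγ, ?_, hbound⟩
    rw [max_eq_left h, mul_zero]
    refine Finset.sum_eq_zero fun t ht => ?_
    rw [Finset.mem_Icc] at ht
    rw [Pi.single_eq_of_ne (by omega), mul_zero]
  · obtain ⟨k, hk, hkM⟩ := Finset.exists_mem_eq_sup' (Finset.nonempty_Icc.mpr hT2) β
    have hk' := Finset.mem_Icc.mp hk
    refine ⟨_, UCLT_single (j := k - 1) (Finset.mem_Icc.mpr ⟨by omega, by omega⟩) hm hσ hγ, ?_,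
      hbound⟩
    rw [max_eq_right h, hM, hkM, Finset.sum_eq_single_of_mem k hk, Pi.single_eq_same, mul_comm]
    intro t ht htk
    rw [Finset.mem_Icc] at ht
    rw [Pi.single_eq_of_ne (by omega), mul_zero]
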